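/- Let H be a separable real Hilbert space, A ∈ L(H), α > 0, y ∈ H and t > 0. Let E_{α,1}(As^α) y := Σ_{i=0}^∞ A^i s^{iα} y / Γ(iα+1) (a convergent series in H). Then A I^α( s ↦ E_{α,1}(A s^α) y )(t) = E_{α,1}(A t^α) y − y; i.e. A · (1/Γ(α)) ∫₀ᵗ (t−s)^{α−1} E_{α,1}(A s^α) y ds = E_{α,1}(A t^α) y − y. -/

import Mathlib

open Set MeasureTheory

/-- The Riemann–Liouville fractional integral of order `α` of an `H`-valued function,
`I^α(f)(t) = (1/Γ(α)) ∫₀ᵗ (t-s)^(α-1) f(s) ds`. -/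
noncomputable def fracInt {H : Type*} [NormedAddCommGroup H] [NormedSpace ℝ H]
    (α : ℝ) (f : ℝ → H) (t : ℝ) : H :=
  if α = 0 then f t
  else (Real.Gamma α)⁻¹ • ∫ s in Set.Ioc (0 : ℝ) t, ((t - s) ^ (α - 1) : ℝ) • f s

lemma ml_gamma_lower (R x : ℝ) (hR : 0 < R) (hx : 0 ≤ x) :
    R ^ x * Real.exp (-R) ≤ Real.Gamma (x + 1) := by
  rw [Real.Gamma_eq_integral (by linarith)]
  have hint : IntegrableOn (fun u : ℝ => Real.exp (-u) * u ^ (x + 1 - 1)) (Ioi 0) :=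
    Real.GammaIntegral_convergent (by linarith)
  have hsub : Ioi R ⊆ Ioi (0 : ℝ) := Ioi_subset_Ioi hR.le
  calc R ^ x * Real.exp (-R) = ∫ u in Ioi R, R ^ x * Real.exp (-u) := by
        rw [integral_const_mul, integral_exp_neg_Ioi]
    _ ≤ ∫ u in Ioi R, Real.exp (-u) * u ^ (x + 1 - 1) := by
        apply setIntegral_mono_on _ (hint.mono_set hsub) measurableSet_Ioi
        · intro u hu
          rw [add_sub_cancel_right, mul_comm]
          have : R ^ x ≤ u ^ x := Real.rpow_le_rpow hR.le (le_of_lt hu) hx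
          gcongr
        · have := integrableOn_exp_neg_Ioi R
          exact this.const_mul _
    _ ≤ _ := by
        apply setIntegral_mono_set hint
        · filter_upwards [ae_restrict_mem measurableSet_Ioi] with u hu
          have : (0 : ℝ) < u := hu
          simp only [Pi.zero_apply]
          positivity
        · exact hsub.eventuallyLE

lemma ml_summable (α c : ℝ) (hα : 0 < α) (hc : 0 < c) :
    Summable (fun i : ℕ => c ^ i / Real.Gamma ((i : ℝ) * α + 1)) := by
  set R : ℝ := (2 * c) ^ (1 / α) with hRdef
  have hR : 0 < R := by positivity
  have hRα : R ^ α = 2 * c := by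
    rw [hRdef, ← Real.rpow_mul (by positivity)]
    field_simp
    simp
  refine Summable.of_nonneg_of_le (f := fun i : ℕ => Real.exp R * (1 / 2 : ℝ) ^ i) ?_ ?_ ?_
  · intro i
    have := Real.Gamma_pos_of_pos (show 0 < (i : ℝ) * α + 1 by positivity)
    positivity
  · intro i
    have hG := Real.Gamma_pos_of_pos (show 0 < (i : ℝ) * α + 1 by positivity)
    have h := ml_gamma_lower R ((i : ℝ) * α) hR (by positivity)
    have h2 : R ^ ((i : ℝ) * α) = (2 * c) ^ i := by
      rw [mul_comm, Real.rpow_mul hR.le, hRα, Real.rpow_natCast]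
    rw [h2] at h
    rw [div_le_iff₀ hG]
    calc c ^ i = Real.exp R * (1 / 2) ^ i * ((2 * c) ^ i * Real.exp (-R)) := by
          rw [Real.exp_neg, mul_pow, div_pow, one_pow]
          field_simp
      _ ≤ _ := by gcongr
  · exact (summable_geometric_of_lt_one (by norm_num) (by norm_num)).mul_left _

lemma ml_beta (α x t : ℝ) (hα : 0 < α) (hx : 0 ≤ x) (ht : 0 < t) :
    ∫ s in Ioc (0 : ℝ) t, (t - s) ^ (α - 1) * s ^ x
      = t ^ (x + α) * (Real.Gamma α * Real.Gamma (x + 1) / Real.Gamma (x + α + 1)) := by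
  have h1 := Complex.betaIntegral_scaled ((x + 1 : ℝ) : ℂ) (α : ℂ) ht
  have h2 := Complex.Gamma_mul_Gamma_eq_betaIntegral (s := ((x + 1 : ℝ) : ℂ)) (t := (α : ℂ))
    (by rw [Complex.ofReal_re]; linarith) (by rw [Complex.ofReal_re]; linarith)
  have hG : Real.Gamma (x + α + 1) ≠ 0 := (Real.Gamma_pos_of_pos (by linarith)).ne'
  have h3 : Complex.betaIntegral ((x + 1 : ℝ) : ℂ) (α : ℂ)
      = ((Real.Gamma α * Real.Gamma (x + 1) / Real.Gamma (x + α + 1) : ℝ) : ℂ) := by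
    have e : ((x + 1 : ℝ) : ℂ) + (α : ℂ) = ((x + α + 1 : ℝ) : ℂ) := by push_cast; ring
    rw [e, Complex.Gamma_ofReal, Complex.Gamma_ofReal, Complex.Gamma_ofReal] at h2
    have hG' : ((Real.Gamma (x + α + 1) : ℝ) : ℂ) ≠ 0 := by exact_mod_cast hG
    rw [Complex.ofReal_div, Complex.ofReal_mul, eq_div_iff hG']
    linear_combination -h2
  apply Complex.ofReal_injective
  rw [h3, intervalIntegral.integral_of_le ht.le] at h1
  rw [← integral_complex_ofReal]
  rw [Complex.ofReal_mul (t ^ (x + α)), Complex.ofReal_cpow ht.le]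
  have e : ((x + 1 : ℝ) : ℂ) + (α : ℂ) - 1 = ((x + α : ℝ) : ℂ) := by push_cast; ring
  rw [e] at h1
  rw [← h1]
  apply setIntegral_congr_fun measurableSet_Ioc
  intro s hs
  simp only
  rw [Complex.ofReal_mul, Complex.ofReal_cpow (by linarith [hs.2]), Complex.ofReal_cpow hs.1.le]
  push_cast
  rw [add_sub_cancel_right, mul_comm]

lemma ml_beta_integrable (α x t : ℝ) (hα : 0 < α) (hx : 0 ≤ x) (ht : 0 < t) :
    IntegrableOn (fun s : ℝ => (t - s) ^ (α - 1) * s ^ x) (Ioc (0 : ℝ) t) := by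
  by_contra h
  have h1 := ml_beta α x t hα hx ht
  rw [integral_undef h] at h1
  have := Real.Gamma_pos_of_pos hα
  have := Real.Gamma_pos_of_pos (show 0 < x + 1 by linarith)
  have := Real.Gamma_pos_of_pos (show 0 < x + α + 1 by linarith)
  have : 0 < t ^ (x + α) * (Real.Gamma α * Real.Gamma (x + 1) / Real.Gamma (x + α + 1)) := by
    positivity
  linarith

lemma ml_norm_pow {H : Type*} [NormedAddCommGroup H] [NormedSpace ℝ H]
    (A : H →L[ℝ] H) (y : H) (i : ℕ) : ‖(A ^ i) y‖ ≤ (‖A‖ + 1) ^ i * ‖y‖ := by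
  induction i with
  | zero => simp
  | succ n ih =>
    rw [pow_succ', mul_apply_eq_comp]
    calc ‖A ((A ^ n) y)‖ ≤ ‖A‖ * ‖(A ^ n) y‖ := A.le_opNorm _
      _ ≤ (‖A‖ + 1) * ((‖A‖ + 1) ^ n * ‖y‖) := by gcongr; linarith
      _ = _ := by ring

lemma ml_summable_vec {H : Type*} [NormedAddCommGroup H] [NormedSpace ℝ H]
    (A : H →L[ℝ] H) (α t : ℝ) (hα : 0 < α) (ht : 0 < t) (y : H) :
    Summable (fun i : ℕ =>
      ‖(t ^ ((i : ℝ) * α) / Real.Gamma ((i : ℝ) * α + 1)) • (A ^ i) y‖) := by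
  have h := (ml_summable α (t ^ α * (‖A‖ + 1)) hα (by positivity)).mul_right ‖y‖
  refine Summable.of_nonneg_of_le (fun _ => norm_nonneg _) (fun i => ?_) h
  have hG := Real.Gamma_pos_of_pos (show 0 < (i : ℝ) * α + 1 by positivity)
  rw [norm_smul, Real.norm_of_nonneg (by positivity), mul_comm (i : ℝ) α, Real.rpow_mul ht.le,
    Real.rpow_natCast, mul_pow, mul_comm α]
  calc _ ≤ (t ^ α) ^ i / Real.Gamma (i * α + 1) * ((‖A‖ + 1) ^ i * ‖y‖) := by
        gcongr
        exact ml_norm_pow A y i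
    _ = _ := by ring

lemma ml_summable_vec' {H : Type*} [NormedAddCommGroup H] [NormedSpace ℝ H]
    (A : H →L[ℝ] H) (α t : ℝ) (hα : 0 < α) (ht : 0 < t) (y : H) :
    Summable (fun i : ℕ =>
      (t ^ (((i + 1 : ℕ) : ℝ) * α) / Real.Gamma (((i + 1 : ℕ) : ℝ) * α + 1)) * ‖(A ^ i) y‖) := by
  have h := ((summable_nat_add_iff 1).2
    (ml_summable α (t ^ α * (‖A‖ + 1)) hα (by positivity))).mul_right ‖y‖
  have hG (i : ℕ) := Real.Gamma_pos_of_pos (show 0 < ((i + 1 : ℕ) : ℝ) * α + 1 by positivity)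
  refine Summable.of_nonneg_of_le (fun i => ?_) (fun i => ?_) h
  · have := hG i
    positivity
  · have := hG i
    rw [mul_comm ((i + 1 : ℕ) : ℝ) α, Real.rpow_mul ht.le,
      Real.rpow_natCast, mul_pow, mul_comm α]
    have h2 : ‖(A ^ i) y‖ ≤ (‖A‖ + 1) ^ (i + 1) * ‖y‖ := by
      refine (ml_norm_pow A y i).trans ?_
      gcongr
      · linarith [norm_nonneg A]
      · omega
    calc _ ≤ (t ^ α) ^ (i + 1) / Real.Gamma (((i + 1 : ℕ) : ℝ) * α + 1)
            * ((‖A‖ + 1) ^ (i + 1) * ‖y‖) := by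
          gcongr
      _ = _ := by ring

/-- The fractional integral of the vector-valued Mittag-Leffler function
`s ↦ E_{α,1}(A s^α) y = ∑ s^{iα} Aⁱ y / Γ(iα+1)` satisfies
`A I^α(E_{α,1}(A ·^α) y)(t) = E_{α,1}(A t^α) y - y`. -/
theorem fracInt_mittag_leffler
    {H : Type*} [NormedAddCommGroup H] [InnerProductSpace ℝ H] [CompleteSpace H]
    [TopologicalSpace.SeparableSpace H]
    (A : H →L[ℝ] H) (α t : ℝ) (hα : 0 < α) (ht : 0 < t) (y : H) :
    A (fracInt α
        (fun s => ∑' i : ℕ, (s ^ ((i : ℝ) * α) / Real.Gamma ((i : ℝ) * α + 1)) • (A ^ i) y)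
        t)
      = (∑' i : ℕ, (t ^ ((i : ℝ) * α) / Real.Gamma ((i : ℝ) * α + 1)) • (A ^ i) y) - y := by
  have hGα := Real.Gamma_pos_of_pos hα
  have hG (i : ℕ) := Real.Gamma_pos_of_pos (show 0 < (i : ℝ) * α + 1 by positivity)
  let g : ℕ → ℝ := fun i => t ^ ((i : ℝ) * α) / Real.Gamma ((i : ℝ) * α + 1)
  let F : ℕ → ℝ → H := fun i s =>
    (((t - s) ^ (α - 1) * s ^ ((i : ℝ) * α)) * (Real.Gamma ((i : ℝ) * α + 1))⁻¹) • (A ^ i) y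
  have hb (i : ℕ) : ∫ s in Ioc (0 : ℝ) t,
      ((t - s) ^ (α - 1) * s ^ ((i : ℝ) * α)) * (Real.Gamma ((i : ℝ) * α + 1))⁻¹
      = Real.Gamma α * g (i + 1) := by
    rw [integral_mul_const, ml_beta α _ t hα (by positivity) ht]
    have e : (i : ℝ) * α + α = ((i + 1 : ℕ) : ℝ) * α := by push_cast; ring
    rw [e]
    have := (hG i).ne'
    simp only [g]
    field_simp
  have hFint (i : ℕ) : IntegrableOn (F i) (Ioc (0 : ℝ) t) :=
    ((ml_beta_integrable α ((i : ℝ) * α) t hα (by positivity) ht).mul_const _).smul_const _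
  have hFI (i : ℕ) : ∫ s in Ioc (0 : ℝ) t, F i s = (Real.Gamma α * g (i + 1)) • (A ^ i) y := by
    simp only [F]
    rw [integral_smul_const, hb]
  have hFn (i : ℕ) : ∫ s in Ioc (0 : ℝ) t, ‖F i s‖
      = Real.Gamma α * (g (i + 1) * ‖(A ^ i) y‖) := by
    rw [← mul_assoc, ← hb, ← integral_mul_const]
    apply setIntegral_congr_fun measurableSet_Ioc
    intro s hs
    have h1 : 0 ≤ t - s := by linarith [hs.2]
    have h2 : 0 < s := hs.1
    have := hG i
    simp only [F]
    rw [norm_smul, Real.norm_of_nonneg (by positivity)]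
  have hsum : Summable (fun i => g (i + 1) * ‖(A ^ i) y‖) := ml_summable_vec' A α t hα ht y
  have key := hasSum_integral_of_summable_integral_norm (μ := volume.restrict (Ioc (0 : ℝ) t))
    hFint (by simp only [hFn]; exact hsum.mul_left _)
  have hint : ∫ s in Ioc (0 : ℝ) t, ((t - s) ^ (α - 1) : ℝ) •
      (∑' i : ℕ, (s ^ ((i : ℝ) * α) / Real.Gamma ((i : ℝ) * α + 1)) • (A ^ i) y)
      = ∫ s in Ioc (0 : ℝ) t, ∑' i, F i s := by
    apply setIntegral_congr_fun measurableSet_Ioc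
    intro s hs
    simp only [F]
    rw [← (ml_summable_vec A α s hα hs.1 y).of_norm.tsum_const_smul]
    congr 1
    ext i
    rw [smul_smul, div_eq_mul_inv, mul_assoc]
  rw [fracInt, if_neg hα.ne', hint]
  simp only [hFI] at key
  have key2 := A.hasSum (key.const_smul (Real.Gamma α)⁻¹)
  have hs := (ml_summable_vec A α t hα ht y).of_norm
  rw [hs.tsum_eq_zero_add, ← key2.tsum_eq]
  have h0 : (t ^ (((0 : ℕ) : ℝ) * α) / Real.Gamma (((0 : ℕ) : ℝ) * α + 1)) • (A ^ 0) y = y := by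
    simp
  rw [h0, add_sub_cancel_left]
  congr 1
  ext i
  simp only [Function.comp, smul_smul, map_smul]
  rw [inv_mul_cancel_left₀ hGα.ne', pow_succ', mul_apply_eq_comp]
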